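/- arXiv:2207.08428 — 2 statements merged into one kernel-verified Lean document; each statement's English description precedes it below -/
import Mathlib

section
/- Let d ≥ 1, let 𝔐 be a finite nonnegative Borel measure on ℝ^d, let (f_j)_{j∈ℕ} be an orthonormal family in L²(𝔐; ℂ), and let G : ℝ^d → ℂ be a bounded continuous function with ∫_{ℝ^d} |G(ξ)|² dξ < ∞. Then ∑_{j=0}^∞ ∫_{ℝ^d} | ∫_{ℝ^d} G(ξ−η) f_j(η) d𝔐(η) |² dξ ≤ 𝔐(ℝ^d) · ∫_{ℝ^d} |G(ξ)|² dξ. -/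
open MeasureTheory Real

/-- Bessel's inequality in `L²(μ)`, for the bilinear pairings `∫ g * f j` of a square integrable
function with an orthonormal family. -/
theorem Orthonormal.sum_norm_integral_mul_sq_le {α ι : Type*} [MeasurableSpace α] {μ : Measure α}
    {f : ι → Lp ℂ 2 μ} (hf : Orthonormal ℂ f) {g : α → ℂ} (hg : MemLp g 2 μ) (s : Finset ι) :
    ∑ j ∈ s, ‖∫ x, g x * f j x ∂μ‖ ^ 2 ≤ ∫ x, ‖g x‖ ^ 2 ∂μ := by
  have hg' : MemLp (fun x => star (g x)) 2 μ := hg.star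
  have h_pairing (j : ι) : ‖inner ℂ (f j) (hg'.toLp _)‖ = ‖∫ x, g x * f j x ∂μ‖ := by
    rw [norm_inner_symm, L2.inner_def]
    congr 1
    refine integral_congr_ae ?_
    filter_upwards [hg'.coeFn_toLp] with x hx
    rw [hx, RCLike.inner_apply, RCLike.star_def, RCLike.conj_conj, mul_comm]
  have h_norm : ‖hg'.toLp _‖ ^ 2 = ∫ x, ‖g x‖ ^ 2 ∂μ := by
    rw [@norm_sq_eq_re_inner ℂ, L2.inner_def, ← integral_re (L2.integrable_inner _ _)]
    refine integral_congr_ae ?_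
    filter_upwards [hg'.coeFn_toLp] with x hx
    rw [hx, ← norm_sq_eq_re_inner, norm_star]
  simpa only [h_pairing, h_norm] using hf.sum_inner_products_le (hg'.toLp _) (s := s)

section Translation

variable {E : Type*} [AddGroup E] [MeasurableSpace E] [MeasurableAdd₂ E] [MeasurableSub₂ E]
  {μ ν : Measure E} [SFinite μ] [μ.IsAddRightInvariant] [IsFiniteMeasure ν] {h : E → ℝ}

theorem integrable_prod_comp_sub (hm : Measurable h) (hi : Integrable h μ) :
    Integrable (fun p : E × E => h (p.1 - p.2)) (μ.prod ν) := by
  have hm' : AEStronglyMeasurable (fun p : E × E => h (p.1 - p.2)) (μ.prod ν) :=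
    (hm.comp measurable_sub).aestronglyMeasurable
  refine (integrable_prod_iff' hm').2 ⟨.of_forall fun y => hi.comp_sub_right y, ?_⟩
  simp only [integral_sub_right_eq_self (fun x => ‖h x‖)]
  exact integrable_const _

theorem integral_integral_comp_sub (hm : Measurable h) (hi : Integrable h μ) :
    ∫ x, ∫ y, h (x - y) ∂ν ∂μ = ν.real Set.univ * ∫ x, h x ∂μ := by
  rw [integral_integral_swap (integrable_prod_comp_sub hm hi)]
  simp only [integral_sub_right_eq_self h, integral_const, smul_eq_mul]

end Translation

/-- For a finite nonnegative measure `𝔐` on `ℝ^d`, an orthonormal family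
`(f_j)` in `L²(𝔐; ℂ)`, and a bounded continuous `G : ℝ^d → ℂ` with `∫ |G|² < ∞`, one has
`∑_j ∫ |∫ G(ξ−η) f_j(η) d𝔐(η)|² dξ ≤ 𝔐(ℝ^d) · ∫ |G|²`. -/
theorem stmt_0 (d : ℕ) (hd : 1 ≤ d)
    (𝔐 : Measure (EuclideanSpace ℝ (Fin d))) [IsFiniteMeasure 𝔐]
    (f : ℕ → Lp ℂ 2 𝔐) (hf : Orthonormal ℂ f)
    (G : EuclideanSpace ℝ (Fin d) → ℂ)
    (hGcont : Continuous G) (hGbdd : ∃ M : ℝ, ∀ x, ‖G x‖ ≤ M)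
    (hGL2 : Integrable (fun ξ => ‖G ξ‖ ^ 2) (volume : Measure (EuclideanSpace ℝ (Fin d)))) :
    ∑' j : ℕ, ∫ ξ, ‖∫ η, G (ξ - η) * (f j : EuclideanSpace ℝ (Fin d) → ℂ) η ∂𝔐‖ ^ 2
        ∂(volume : Measure (EuclideanSpace ℝ (Fin d)))
      ≤ (𝔐 Set.univ).toReal *
        ∫ ξ, ‖G ξ‖ ^ 2 ∂(volume : Measure (EuclideanSpace ℝ (Fin d))) := by
  obtain ⟨M, hM⟩ := hGbdd
  have hm : Measurable fun ξ => ‖G ξ‖ ^ 2 := (hGcont.norm.pow 2).measurable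
  have h_bessel (s : Finset ℕ) (ξ : EuclideanSpace ℝ (Fin d)) :
      ∑ j ∈ s, ‖∫ η, G (ξ - η) * f j η ∂𝔐‖ ^ 2 ≤ ∫ η, ‖G (ξ - η)‖ ^ 2 ∂𝔐 := by
    have hGξ : Continuous fun η => G (ξ - η) := by fun_prop
    exact hf.sum_norm_integral_mul_sq_le
      (.of_bound hGξ.aestronglyMeasurable M (.of_forall fun η => hM _)) s
  have h_int : Integrable (fun ξ => ∫ η, ‖G (ξ - η)‖ ^ 2 ∂𝔐) :=
    (integrable_prod_comp_sub hm hGL2).integral_prod_left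
  have h_conv_int (j : ℕ) : Integrable (fun ξ => ‖∫ η, G (ξ - η) * f j η ∂𝔐‖ ^ 2) := by
    have h_meas : StronglyMeasurable fun p : EuclideanSpace ℝ (Fin d) × EuclideanSpace ℝ (Fin d) =>
        G (p.1 - p.2) * f j p.2 :=
      (hGcont.comp continuous_sub).stronglyMeasurable.mul
        ((Lp.stronglyMeasurable (f j)).comp_measurable measurable_snd)
    refine h_int.mono' (h_meas.integral_prod_right.norm.pow 2).aestronglyMeasurable
      (.of_forall fun ξ => ?_)
    simpa using h_bessel {j} ξ
  refine tsum_le_of_sum_le' (by positivity) fun s => ?_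
  rw [← integral_finsetSum s fun j _ => h_conv_int j]
  exact (integral_mono (integrable_finsetSum s fun j _ => h_conv_int j) h_int (h_bessel s)).trans_eq
    (integral_integral_comp_sub hm hGL2)
end

section
/- Let d ≥ 1 and let f : ℝ^d → ℝ be a smooth function such that there exists c > 0 with f(x) ≥ c for all x ∈ ℝ^d, and such that for every n ∈ ℕ there exists C_n > 0 with ‖D^n f(x)‖ ≤ C_n ⟨x⟩^{−n} for all x ∈ ℝ^d. Then the function x ↦ √(f(x)) is smooth and for every n ∈ ℕ there exists C′_n > 0 with ‖D^n (√f)(x)‖ ≤ C′_n ⟨x⟩^{−n} for all x ∈ ℝ^d. -/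
open Real

/-- Composing a function whose `n`-th derivatives are `O(w ^ n)` and whose values lie in a compact
set `K` with a function that is smooth near `K` preserves the derivative bounds. -/
theorem exists_norm_iteratedFDeriv_comp_le {E F G : Type*}
    [NormedAddCommGroup E] [NormedSpace ℝ E] [NormedAddCommGroup F] [NormedSpace ℝ F]
    [NormedAddCommGroup G] [NormedSpace ℝ G] {g : F → G} {f : E → F} {t K : Set F} {w : E → ℝ}
    (ht : IsOpen t) (hK : IsCompact K) (hKt : K ⊆ t) (hfK : ∀ x, f x ∈ K)
    (hg : ContDiffOn ℝ (⊤ : ℕ∞) g t) (hf : ContDiff ℝ (⊤ : ℕ∞) f) (hw : ∀ x, 0 ≤ w x)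
    (hfw : ∀ n : ℕ, ∃ C : ℝ, 0 < C ∧ ∀ x, ‖iteratedFDeriv ℝ n f x‖ ≤ C * w x ^ n) (n : ℕ) :
    ∃ C : ℝ, 0 < C ∧ ∀ x, ‖iteratedFDeriv ℝ n (g ∘ f) x‖ ≤ C * w x ^ n := by
  choose A hA0 hA using hfw
  have hn (i : ℕ) : (i : WithTop ℕ∞) ≤ ((⊤ : ℕ∞) : WithTop ℕ∞) := by exact_mod_cast le_top
  have hB (i : ℕ) : ∃ B, ∀ y ∈ K, ‖iteratedFDerivWithin ℝ i g t y‖ ≤ B :=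
    hK.exists_bound_of_continuousOn
      ((hg.continuousOn_iteratedFDerivWithin (hn i) ht.uniqueDiffOn).mono hKt)
  choose B hB using hB
  set M : ℝ := 1 + ∑ i ∈ Finset.range (n + 1), |B i|
  set D : ℝ := 1 + ∑ i ∈ Finset.range (n + 1), A i
  have hM : 0 < M := by positivity
  have hD : 1 ≤ D := le_add_of_nonneg_right (Finset.sum_nonneg fun i _ => (hA0 i).le)
  refine ⟨n.factorial * M * D ^ n, by positivity, fun x => ?_⟩
  have key := norm_iteratedFDeriv_comp_le' (n := n) (C := M) (D := D * w x)
    (Set.range_subset_iff.2 fun y => hKt (hfK y)) ht.uniqueDiffOn hg hf (hn n) x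
    (fun i hi => ?_) (fun i hi1 hi => ?_)
  · rwa [mul_pow, ← mul_assoc] at key
  · have h := Finset.single_le_sum (f := fun i => |B i|) (fun j _ => abs_nonneg _)
      (Finset.mem_range.2 (Nat.lt_succ_of_le hi))
    linarith [hB i _ (hfK x), le_abs_self (B i)]
  · have h := Finset.single_le_sum (f := A) (fun j _ => (hA0 j).le)
      (Finset.mem_range.2 (Nat.lt_succ_of_le hi))
    have hAD : A i ≤ D ^ i := by linarith [le_self_pow₀ hD (by omega : i ≠ 0)]
    rw [mul_pow]
    exact (hA i x).trans (mul_le_mul_of_nonneg_right hAD (pow_nonneg (hw x) i))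

/-- If `f : ℝ^d → ℝ` is smooth, bounded below by `c > 0`, and satisfies the
`S^{0,0}` bounds `‖D^n f(x)‖ ≤ C_n ⟨x⟩^{−n}`, then `√f` is smooth and satisfies `S^{0,0}`
bounds as well.  Here `⟨x⟩ = (1+|x|²)^{1/2}`. -/
theorem stmt_4 (d : ℕ) (hd : 1 ≤ d)
    (f : EuclideanSpace ℝ (Fin d) → ℝ) (hf : ContDiff ℝ (⊤ : ℕ∞) f)
    (c : ℝ) (hc : 0 < c) (hfc : ∀ x, c ≤ f x)
    (hsym : ∀ n : ℕ, ∃ C : ℝ, 0 < C ∧ ∀ x,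
      ‖iteratedFDeriv ℝ n f x‖ ≤ C * (Real.sqrt (1 + ‖x‖ ^ 2)) ^ (-(n : ℝ))) :
    ContDiff ℝ (⊤ : ℕ∞) (fun x => Real.sqrt (f x)) ∧
    ∀ n : ℕ, ∃ C' : ℝ, 0 < C' ∧ ∀ x,
      ‖iteratedFDeriv ℝ n (fun x => Real.sqrt (f x)) x‖ ≤
        C' * (Real.sqrt (1 + ‖x‖ ^ 2)) ^ (-(n : ℝ)) := by
  have hw (n : ℕ) (x : EuclideanSpace ℝ (Fin d)) :
      (Real.sqrt (1 + ‖x‖ ^ 2)) ^ (-(n : ℝ)) = (Real.sqrt (1 + ‖x‖ ^ 2))⁻¹ ^ n := by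
    rw [Real.rpow_neg (Real.sqrt_nonneg _), Real.rpow_natCast, inv_pow]
  simp only [hw] at hsym ⊢
  have hpos x : 0 < f x := hc.trans_le (hfc x)
  refine ⟨hf.sqrt fun x => (hpos x).ne', ?_⟩
  obtain ⟨C, -, hC⟩ := hsym 0
  refine exists_norm_iteratedFDeriv_comp_le (g := Real.sqrt) (t := Set.Ioi 0) (K := Set.Icc c C)
    isOpen_Ioi isCompact_Icc (fun y hy => hc.trans_le hy.1) (fun x => ⟨hfc x, ?_⟩)
    (contDiffOn_id.sqrt fun y hy => ne_of_gt hy) hf (fun x => by positivity) hsym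
  have h := hC x
  rw [norm_iteratedFDeriv_zero, pow_zero, mul_one] at h
  exact (le_abs_self _).trans h
end
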